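/- Fix θ, σ, t > 0 and 0 ≤ a < b ≤ π. Let u : [0,π] → (Ω → ℝ) be a centered Gaussian random field with covariance E[u(x)u(y)] = Σ_{k=1}^∞ (σ²/(θπk²)) (1 − e^{−2θk²t}) sin(kx) sin(ky). For m ∈ ℕ set x_j := a + (b−a)j/m, j = 0, …, m. Then the quadratic variation sums Σ_{j=1}^m ( u(x_j) − u(x_{j−1}) )² converge in probability, as m → ∞, to σ²(b−a)/(2θ). -/

import Mathlib

open MeasureTheory ProbabilityTheory Real Filter

noncomputable section

/-- `u` is a centered Gaussian random field on `S` with covariance function `C`: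
every finite linear combination of its values at points of `S` is a centered real
Gaussian with the corresponding variance. -/
def IsCenteredGaussianField {Ω : Type*} [MeasurableSpace Ω] (P : Measure Ω)
    (u : ℝ → Ω → ℝ) (S : Set ℝ) (C : ℝ → ℝ → ℝ) : Prop :=
  ∀ (n : ℕ) (x : Fin n → ℝ), (∀ i, x i ∈ S) → ∀ a : Fin n → ℝ,
    Measure.map (fun ω => ∑ i, a i * u (x i) ω) P
      = gaussianReal 0 (∑ i, ∑ j, a i * a j * C (x i) (x j)).toNNReal

/-- Spatial covariance, at a fixed time `t`, of the solution of the stochastic heat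
equation `du − θΔu dt = σ dW` on `[0, π]` with zero initial and Dirichlet boundary
conditions: `E[u(x)u(y)] = Σ_{k≥1} (σ²/(θπk²))(1 − e^{−2θk²t}) sin(kx) sin(ky)`. -/
def heatCovSpace (θ σ t x y : ℝ) : ℝ :=
  ∑' k : ℕ, (σ ^ 2 / (θ * π * ((k : ℝ) + 1) ^ 2)) *
    (1 - Real.exp (-(2 * θ * ((k : ℝ) + 1) ^ 2 * t))) *
    Real.sin (((k : ℝ) + 1) * x) * Real.sin (((k : ℝ) + 1) * y)

/-- The fourth moment of a centered real Gaussian of variance `v` is `3 v ^ 2`. -/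
theorem integral_pow_four_gaussianReal (v : NNReal) :
    ∫ x, x ^ 4 ∂gaussianReal 0 v = 3 * (v : ℝ) ^ 2 := by
  have key := iteratedDeriv_mgf_zero (X := id) (μ := gaussianReal 0 v) (by simp) 4
  have hderiv : ∀ (f f' : ℝ → ℝ), (∀ x, HasDerivAt f (f' x) x) →
      deriv (fun x => f x * exp (v * x ^ 2 / 2))
        = fun x => (f' x + v * x * f x) * exp (v * x ^ 2 / 2) := by
    intro f f' hf
    funext x
    have hq : HasDerivAt (fun x : ℝ => (v : ℝ) * x ^ 2 / 2) (v * x) x := by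
      convert! (((hasDerivAt_id x).pow 2).const_mul (v : ℝ)).div_const 2 using 1
      simp; ring
    refine HasDerivAt.deriv ?_
    convert! (hf x).mul hq.exp using 1
    ring
  have h0 : mgf id (gaussianReal 0 v) = fun t => (1 : ℝ) * exp (v * t ^ 2 / 2) := by
    rw [mgf_id_gaussianReal]; simp
  rw [h0, iteratedDeriv_eq_iterate] at key
  simp only [Function.iterate_succ, Function.comp_apply, Function.iterate_zero, id] at key
  rw [hderiv (fun _ => 1) (fun _ => 0) (fun x => hasDerivAt_const x 1)] at key
  rw [hderiv (fun x => 0 + v * x * 1) (fun _ => v) (fun x => by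
    convert! (hasDerivAt_id x).const_mul (v : ℝ) using 1
    · funext y; simp
    · simp)] at key
  rw [hderiv (fun x => v + v * x * (0 + v * x * 1)) (fun x => 2 * v ^ 2 * x) (fun x => by
    convert! (((hasDerivAt_id x).pow 2).const_mul ((v : ℝ) ^ 2)).const_add (v : ℝ) using 1
    · funext y; simp; ring
    · simp; ring)] at key
  rw [hderiv (fun x => 2 * v ^ 2 * x + v * x * (v + v * x * (0 + v * x * 1)))
    (fun x => 3 * v ^ 2 + 3 * v ^ 3 * x ^ 2) (fun x => by
    convert! ((hasDerivAt_id x).const_mul (3 * (v : ℝ) ^ 2)).add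
      (((hasDerivAt_id x).pow 3).const_mul ((v : ℝ) ^ 3)) using 1
    · funext y; simp; ring
    · simp; ring)] at key
  simp at key
  exact key.symm

/-- Wick's formula for the squares of two jointly Gaussian centered variables with
variances `p`, `q` and covariance `r`. -/
theorem integral_sq_mul_sq_of_gaussian {Ω : Type*} [MeasurableSpace Ω] {P : Measure Ω}
    [IsProbabilityMeasure P] {X Y : Ω → ℝ} {p q r : ℝ}
    (h0 : ∀ s t : ℝ, 0 ≤ s ^ 2 * p + 2 * s * t * r + t ^ 2 * q)
    (h : ∀ s t : ℝ, P.map (fun ω => s * X ω + t * Y ω)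
      = gaussianReal 0 (s ^ 2 * p + 2 * s * t * r + t ^ 2 * q).toNNReal) :
    (Integrable (fun ω => X ω ^ 2) P ∧ ∫ ω, X ω ^ 2 ∂P = p) ∧
    (Integrable (fun ω => X ω ^ 2 * Y ω ^ 2) P ∧
      ∫ ω, X ω ^ 2 * Y ω ^ 2 ∂P = p * q + 2 * r ^ 2) := by
  have hm (s t : ℝ) : AEMeasurable (fun ω => s * X ω + t * Y ω) P := by
    refine AEMeasurable.of_map_ne_zero ?_
    rw [h]
    exact IsProbabilityMeasure.ne_zero _
  have hint (s t : ℝ) (n : ℕ) : Integrable (fun ω => (s * X ω + t * Y ω) ^ n) P := by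
    have hg : Integrable (fun x : ℝ => x ^ n) (P.map (fun ω => s * X ω + t * Y ω)) := by
      rw [h]
      exact integrable_pow_of_mem_interior_integrableExpSet (X := id) (by simp) n
    exact hg.comp_aemeasurable (hm s t)
  have hval (s t : ℝ) (n : ℕ) : ∫ ω, (s * X ω + t * Y ω) ^ n ∂P
      = ∫ x, x ^ n ∂gaussianReal 0 (s ^ 2 * p + 2 * s * t * r + t ^ 2 * q).toNNReal := by
    rw [← h, integral_map (hm s t) (by fun_prop)]
  have h4 (s t : ℝ) : ∫ ω, (s * X ω + t * Y ω) ^ 4 ∂P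
      = 3 * (s ^ 2 * p + 2 * s * t * r + t ^ 2 * q) ^ 2 := by
    rw [hval, integral_pow_four_gaussianReal, Real.coe_toNNReal _ (h0 s t)]
  have hX2 : ∫ ω, X ω ^ 2 ∂P = p := by
    have h1 := hval 1 0 2
    have h2 := variance_fun_id_gaussianReal (μ := 0)
      (v := ((1 : ℝ) ^ 2 * p + 2 * 1 * 0 * r + 0 ^ 2 * q).toNNReal)
    rw [variance_of_integral_eq_zero (by fun_prop) (by simp)] at h2
    rw [h2, Real.coe_toNNReal _ (h0 1 0)] at h1
    simpa using h1
  have hdecomp : (fun ω => X ω ^ 2 * Y ω ^ 2) = fun ω =>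
      (1 / 12) * ((1 * X ω + 1 * Y ω) ^ 4 + (1 * X ω + (-1) * Y ω) ^ 4
        - 2 * (1 * X ω + 0 * Y ω) ^ 4 - 2 * (0 * X ω + 1 * Y ω) ^ 4) := by
    funext ω; ring
  have i1 := hint 1 1 4
  have i2 := hint 1 (-1) 4
  have i3 := (hint 1 0 4).const_mul 2
  have i4 := (hint 0 1 4).const_mul 2
  have i12 : Integrable (fun ω => (1 * X ω + 1 * Y ω) ^ 4 + (1 * X ω + (-1) * Y ω) ^ 4) P :=
    i1.add i2
  have i123 : Integrable (fun ω => (1 * X ω + 1 * Y ω) ^ 4 + (1 * X ω + (-1) * Y ω) ^ 4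
      - 2 * (1 * X ω + 0 * Y ω) ^ 4) P := i12.sub i3
  refine ⟨⟨by simpa using hint 1 0 2, hX2⟩, ?_, ?_⟩
  · rw [hdecomp]
    exact (i123.sub i4).const_mul _
  · rw [hdecomp, integral_const_mul, integral_sub i123 i4,
      integral_sub i12 i3, integral_add i1 i2, integral_const_mul, integral_const_mul,
      h4, h4, h4, h4]
    ring

/-- Mean square error of a sum of squares, given the mixed moments of the summands. -/
theorem integral_sum_sq_sub_sq {Ω ι : Type*} [MeasurableSpace Ω] {P : Measure Ω}
    [IsProbabilityMeasure P] (s : Finset ι) (D : ι → Ω → ℝ) (ρ : ι → ι → ℝ) (L : ℝ)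
    (h2 : ∀ i ∈ s, Integrable (fun ω => D i ω ^ 2) P ∧ ∫ ω, D i ω ^ 2 ∂P = ρ i i)
    (h4 : ∀ i ∈ s, ∀ j ∈ s, Integrable (fun ω => D i ω ^ 2 * D j ω ^ 2) P ∧
      ∫ ω, D i ω ^ 2 * D j ω ^ 2 ∂P = ρ i i * ρ j j + 2 * ρ i j ^ 2) :
    Integrable (fun ω => (∑ i ∈ s, D i ω ^ 2 - L) ^ 2) P ∧
      ∫ ω, (∑ i ∈ s, D i ω ^ 2 - L) ^ 2 ∂P
        = (∑ i ∈ s, ρ i i - L) ^ 2 + 2 * ∑ i ∈ s, ∑ j ∈ s, ρ i j ^ 2 := by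
  have hdecomp : (fun ω => (∑ i ∈ s, D i ω ^ 2 - L) ^ 2) = fun ω =>
      (∑ i ∈ s, ∑ j ∈ s, D i ω ^ 2 * D j ω ^ 2) - 2 * L * (∑ i ∈ s, D i ω ^ 2) + L ^ 2 := by
    funext ω
    rw [← Finset.sum_mul_sum]
    ring
  have i4 : Integrable (fun ω => ∑ i ∈ s, ∑ j ∈ s, D i ω ^ 2 * D j ω ^ 2) P :=
    integrable_finsetSum _ fun i hi => integrable_finsetSum _ fun j hj => (h4 i hi j hj).1
  have i2 : Integrable (fun ω => 2 * L * ∑ i ∈ s, D i ω ^ 2) P :=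
    (integrable_finsetSum _ fun i hi => (h2 i hi).1).const_mul _
  have i42 : Integrable (fun ω => (∑ i ∈ s, ∑ j ∈ s, D i ω ^ 2 * D j ω ^ 2)
      - 2 * L * ∑ i ∈ s, D i ω ^ 2) P := i4.sub i2
  rw [hdecomp]
  refine ⟨i42.add (integrable_const _), ?_⟩
  rw [integral_add i42 (integrable_const _), integral_sub i4 i2, integral_const_mul,
    integral_finsetSum _ fun i hi => integrable_finsetSum _ fun j hj => (h4 i hi j hj).1,
    integral_finsetSum _ fun i hi => (h2 i hi).1,
    Finset.sum_congr rfl fun i hi => integral_finsetSum _ fun j hj => (h4 i hi j hj).1,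
    Finset.sum_congr rfl fun i hi => Finset.sum_congr rfl fun j hj => (h4 i hi j hj).2,
    Finset.sum_congr rfl fun i hi => (h2 i hi).2]
  simp only [Finset.sum_add_distrib, ← Finset.mul_sum, ← Finset.sum_mul, integral_const]
  simp
  ring

/-- Convergence in mean square, stated with Bochner integrals, implies convergence in measure. -/
theorem tendstoInMeasure_of_tendsto_integral_sq {Ω : Type*} [MeasurableSpace Ω] {P : Measure Ω}
    [IsProbabilityMeasure P] {S : ℕ → Ω → ℝ} {L : ℝ}
    (hint : ∀ m, 0 < m → Integrable (fun ω => (S m ω - L) ^ 2) P)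
    (hlim : Tendsto (fun m => ∫ ω, (S m ω - L) ^ 2 ∂P) atTop (nhds 0)) :
    TendstoInMeasure P S atTop (fun _ => L) := by
  rw [tendstoInMeasure_iff_measureReal_norm]
  intro ε hε
  have hb : Tendsto (fun m => (∫ ω, (S m ω - L) ^ 2 ∂P) / ε ^ 2) atTop (nhds 0) := by
    simpa using hlim.div_const (ε ^ 2)
  refine squeeze_zero' (Eventually.of_forall fun _ => measureReal_nonneg) ?_ hb
  filter_upwards [eventually_gt_atTop 0] with m hm
  rw [le_div_iff₀ (by positivity), mul_comm]
  refine le_trans (mul_le_mul_of_nonneg_left ?_ (by positivity))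
    (mul_meas_ge_le_integral_of_nonneg (Eventually.of_forall fun ω => sq_nonneg (S m ω - L))
      (hint m hm) (ε ^ 2))
  refine measureReal_mono fun ω (hω : ε ≤ ‖S m ω - L‖) => ?_
  change ε ^ 2 ≤ (S m ω - L) ^ 2
  rw [← sq_abs (S m ω - L)]
  exact pow_le_pow_left₀ hε.le hω 2

/-- The increment of a covariance function over `[x', x] × [y', y]`. -/
def covIncrement (C : ℝ → ℝ → ℝ) (x' x y' y : ℝ) : ℝ :=
  C x y - C x y' - C x' y + C x' y'

theorem covIncrement_comm {C : ℝ → ℝ → ℝ} (hC : ∀ x y, C x y = C y x) (x' x y' y : ℝ) :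
    covIncrement C x' x y' y = covIncrement C y' y x' x := by
  unfold covIncrement
  rw [hC x y, hC x y', hC x' y, hC x' y']
  ring

section Series

variable {w : ℕ → ℝ}

theorem summable_mul_sin_mul_sin (hw : Summable w) (hw0 : ∀ k, 0 ≤ w k) (x y : ℝ) :
    Summable fun k : ℕ => w k * sin (((k : ℝ) + 1) * x) * sin (((k : ℝ) + 1) * y) := by
  refine Summable.of_norm_bounded hw fun k => ?_
  rw [norm_mul, norm_mul, Real.norm_eq_abs, Real.norm_eq_abs, Real.norm_eq_abs,
    abs_of_nonneg (hw0 k), mul_assoc]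
  exact mul_le_of_le_one_right (hw0 k)
    (mul_le_one₀ (abs_sin_le_one _) (abs_nonneg _) (abs_sin_le_one _))

/-- The covariance `Σ_k w_k sin((k+1)x) sin((k+1)y)`. -/
def sineCov (w : ℕ → ℝ) (x y : ℝ) : ℝ :=
  ∑' k : ℕ, w k * sin (((k : ℝ) + 1) * x) * sin (((k : ℝ) + 1) * y)

theorem sineCov_comm (w : ℕ → ℝ) (x y : ℝ) : sineCov w x y = sineCov w y x :=
  tsum_congr fun _ => by ring

theorem hasSum_covIncrement_sineCov (hw : Summable w) (hw0 : ∀ k, 0 ≤ w k) (x' x y' y : ℝ) :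
    HasSum (fun k : ℕ => w k * (sin (((k : ℝ) + 1) * x) - sin (((k : ℝ) + 1) * x'))
      * (sin (((k : ℝ) + 1) * y) - sin (((k : ℝ) + 1) * y')))
      (covIncrement (sineCov w) x' x y' y) := by
  have h (x y : ℝ) := (summable_mul_sin_mul_sin hw hw0 x y).hasSum
  convert! (((h x y).sub (h x y')).sub (h x' y)).add (h x' y') using 1
  funext k
  ring

theorem sineCov_quadratic_nonneg (hw : Summable w) (hw0 : ∀ k, 0 ≤ w k) (x' x y' y s t : ℝ) :
    0 ≤ s ^ 2 * covIncrement (sineCov w) x' x x' x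
      + 2 * s * t * covIncrement (sineCov w) x' x y' y
      + t ^ 2 * covIncrement (sineCov w) y' y y' y := by
  have h := hasSum_covIncrement_sineCov hw hw0
  refine (((h x' x x' x).mul_left (s ^ 2)).add ((h x' x y' y).mul_left (2 * s * t))).add
    ((h y' y y' y).mul_left (t ^ 2)) |>.nonneg fun k => ?_
  have := mul_nonneg (hw0 k) (sq_nonneg (s * (sin (((k : ℝ) + 1) * x) - sin (((k : ℝ) + 1) * x'))
    + t * (sin (((k : ℝ) + 1) * y) - sin (((k : ℝ) + 1) * y'))))
  refine this.trans_eq ?_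
  ring

theorem abs_covIncrement_sineCov_le (hw0 : ∀ k, 0 ≤ w k)
    (hw : Summable fun k : ℕ => w k * ((k : ℝ) + 1) ^ 2) (x' x y' y : ℝ) :
    |covIncrement (sineCov w) x' x y' y|
      ≤ (∑' k : ℕ, w k * ((k : ℝ) + 1) ^ 2) * (|x - x'| * |y - y'|) := by
  have hws : Summable w := hw.of_nonneg_of_le hw0 fun k =>
    le_mul_of_one_le_right (hw0 k) (one_le_pow₀ (by linarith [(Nat.cast_nonneg k : (0 : ℝ) ≤ k)]))
  rw [← Real.norm_eq_abs]
  refine HasSum.norm_le_of_bounded (hasSum_covIncrement_sineCov hws hw0 x' x y' y)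
    (hw.hasSum.mul_right _) fun k => ?_
  have hs (x x' : ℝ) : |sin (((k : ℝ) + 1) * x) - sin (((k : ℝ) + 1) * x')|
      ≤ ((k : ℝ) + 1) * |x - x'| := by
    refine (abs_sin_sub_sin_le _ _).trans_eq ?_
    rw [← mul_sub, abs_mul, abs_of_pos (by positivity : (0 : ℝ) < k + 1)]
  rw [norm_mul, norm_mul, Real.norm_eq_abs, Real.norm_eq_abs, Real.norm_eq_abs,
    abs_of_nonneg (hw0 k)]
  calc w k * _ * _ ≤ w k * (((k : ℝ) + 1) * |x - x'|) * (((k : ℝ) + 1) * |y - y'|) := by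
        have := hw0 k
        gcongr
        · exact hs x x'
        · exact hs y y'
    _ = _ := by ring

end Series

theorem summable_one_div_succ_sq : Summable fun k : ℕ => 1 / ((k : ℝ) + 1) ^ 2 := by
  have := (summable_nat_add_iff 1).2 (Real.summable_one_div_nat_pow.2 (by norm_num : 1 < 2))
  simpa using this

theorem hasSum_cos_div_succ_sq {y : ℝ} (h0 : 0 ≤ y) (h1 : y ≤ 2 * π) :
    HasSum (fun k : ℕ => cos (((k : ℝ) + 1) * y) / ((k : ℝ) + 1) ^ 2)
      (π ^ 2 / 6 - π * y / 2 + y ^ 2 / 4) := by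
  have hπ := pi_pos
  have h := hasSum_one_div_nat_pow_mul_cos (k := 1) one_ne_zero (x := y / (2 * π))
    ⟨by positivity, by rw [div_le_one (by positivity)]; exact h1⟩
  change HasSum _ (_ * bernoulliFun 2 (y / (2 * π))) at h
  rw [bernoulliFun_two, ← hasSum_nat_add_iff' 1] at h
  convert! h using 1
  · funext k
    have : 2 * π * ((k + 1 : ℕ) : ℝ) * (y / (2 * π)) = ((k : ℝ) + 1) * y := by
      push_cast; field_simp
    rw [this]
    push_cast
    ring
  · simp [Nat.factorial]
    field_simp
    ring

/-- Karhunen-Loève expansion of the covariance of the Brownian bridge on `[0, π]`. -/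
theorem hasSum_sin_mul_sin_div_succ_sq {x y : ℝ} (hx : x ∈ Set.Icc 0 π) (hy : y ∈ Set.Icc 0 π) :
    HasSum (fun k : ℕ => 1 / ((k : ℝ) + 1) ^ 2 * sin (((k : ℝ) + 1) * x) * sin (((k : ℝ) + 1) * y))
      (π / 2 * (min x y - x * y / π)) := by
  wlog hxy : x ≤ y generalizing x y
  · convert! this hy hx (le_of_not_ge hxy) using 1
    · funext k; ring
    · rw [min_comm, mul_comm x y]
  have hπ := pi_pos
  have h := ((hasSum_cos_div_succ_sq (y := y - x) (by linarith)
    (by linarith [hx.1, hy.2])).sub (hasSum_cos_div_succ_sq (y := x + y)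
    (by linarith [hx.1, hy.1]) (by linarith [hx.2, hy.2]))).div_const 2
  convert! h using 1
  · funext k
    rw [mul_sub, mul_add, cos_sub, cos_add]
    ring
  · rw [min_eq_left hxy]
    field_simp
    ring

theorem heatCovSpace_eq_sineCov (θ σ t : ℝ) :
    heatCovSpace θ σ t = sineCov fun k => σ ^ 2 / (θ * π * ((k : ℝ) + 1) ^ 2) *
      (1 - exp (-(2 * θ * ((k : ℝ) + 1) ^ 2 * t))) := rfl

section Heat

variable {θ σ t : ℝ}

theorem heatCov_weight_nonneg (hθ : 0 < θ) (ht : 0 < t) (k : ℕ) :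
    0 ≤ σ ^ 2 / (θ * π * ((k : ℝ) + 1) ^ 2) * (1 - exp (-(2 * θ * ((k : ℝ) + 1) ^ 2 * t))) := by
  have := pi_pos
  refine mul_nonneg (by positivity) (sub_nonneg.2 (exp_le_one_iff.2 ?_))
  have : 0 ≤ 2 * θ * ((k : ℝ) + 1) ^ 2 * t := by positivity
  linarith

theorem summable_heatCov_weight (hθ : 0 < θ) (ht : 0 < t) :
    Summable fun k : ℕ => σ ^ 2 / (θ * π * ((k : ℝ) + 1) ^ 2) *
      (1 - exp (-(2 * θ * ((k : ℝ) + 1) ^ 2 * t))) := by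
  have := pi_pos
  refine (summable_one_div_succ_sq.mul_left (σ ^ 2 / (θ * π))).of_nonneg_of_le
    (heatCov_weight_nonneg hθ ht) fun k => ?_
  rw [div_mul_div_comm, mul_one]
  exact mul_le_of_le_one_right (by positivity)
    (by linarith [exp_pos (-(2 * θ * ((k : ℝ) + 1) ^ 2 * t))])

/-- Increments of the covariance of the stochastic heat equation agree with those of a scaled
Brownian motion up to an error of the order of the area. -/
theorem exists_abs_covIncrement_heatCov_sub_le (hθ : 0 < θ) (ht : 0 < t) :
    ∃ K : ℝ, ∀ x' ∈ Set.Icc 0 π, ∀ x ∈ Set.Icc 0 π, ∀ y' ∈ Set.Icc 0 π,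
      ∀ y ∈ Set.Icc 0 π,
      |covIncrement (heatCovSpace θ σ t) x' x y' y
        - σ ^ 2 / (2 * θ) * covIncrement min x' x y' y| ≤ K * (|x - x'| * |y - y'|) := by
  have hπ := pi_pos
  set r : ℕ → ℝ := fun k => σ ^ 2 / (θ * π * ((k : ℝ) + 1) ^ 2) *
    exp (-(2 * θ * ((k : ℝ) + 1) ^ 2 * t)) with hr
  have hr0 (k : ℕ) : 0 ≤ r k := by positivity
  have hrs : Summable fun k : ℕ => r k * ((k : ℝ) + 1) ^ 2 := by
    refine (summable_one_div_succ_sq.mul_left (σ ^ 2 / (θ * π) * (1 / (2 * θ * t)))).of_nonneg_of_le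
      (fun k => mul_nonneg (hr0 k) (by positivity)) fun k => ?_
    have he : exp (-(2 * θ * ((k : ℝ) + 1) ^ 2 * t)) ≤ 1 / (2 * θ * ((k : ℝ) + 1) ^ 2 * t) := by
      rw [exp_neg, ← one_div]
      exact one_div_le_one_div_of_le (by positivity) (by
        linarith [add_one_le_exp (2 * θ * ((k : ℝ) + 1) ^ 2 * t)])
    calc r k * ((k : ℝ) + 1) ^ 2
        = σ ^ 2 / (θ * π) * exp (-(2 * θ * ((k : ℝ) + 1) ^ 2 * t)) := by
          simp only [hr]; field_simp
      _ ≤ σ ^ 2 / (θ * π) * (1 / (2 * θ * ((k : ℝ) + 1) ^ 2 * t)) := by gcongr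
      _ = _ := by field_simp
  have hrs' : Summable r := hrs.of_nonneg_of_le hr0 fun k =>
    le_mul_of_one_le_right (hr0 k) (one_le_pow₀ (by linarith [(Nat.cast_nonneg k : (0 : ℝ) ≤ k)]))
  have hC {x y : ℝ} (hx : x ∈ Set.Icc 0 π) (hy : y ∈ Set.Icc 0 π) :
      heatCovSpace θ σ t x y
        = σ ^ 2 / (2 * θ) * (min x y - x * y / π) - sineCov r x y := by
    have h1 := (hasSum_sin_mul_sin_div_succ_sq hx hy).mul_left (σ ^ 2 / (θ * π))
    have h2 := h1.sub (summable_mul_sin_mul_sin hrs' hr0 x y).hasSum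
    have h3 : σ ^ 2 / (θ * π) * (π / 2 * (min x y - x * y / π))
        = σ ^ 2 / (2 * θ) * (min x y - x * y / π) := by field_simp
    rw [← h3]
    refine Eq.trans (tsum_congr fun k => ?_) h2.tsum_eq
    simp only [hr]
    field_simp
  refine ⟨σ ^ 2 / (2 * θ) / π + ∑' k : ℕ, r k * ((k : ℝ) + 1) ^ 2,
    fun x' hx' x hx y' hy' y hy => ?_⟩
  have key : covIncrement (heatCovSpace θ σ t) x' x y' y
        - σ ^ 2 / (2 * θ) * covIncrement min x' x y' y
      = -(σ ^ 2 / (2 * θ) / π * ((x - x') * (y - y'))) - covIncrement (sineCov r) x' x y' y := by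
    simp only [covIncrement, hC hx hy, hC hx hy', hC hx' hy, hC hx' hy']
    ring
  rw [key, add_mul]
  refine (abs_sub _ _).trans (add_le_add (le_of_eq ?_) (abs_covIncrement_sineCov_le hr0 hrs _ _ _ _))
  rw [abs_neg, abs_mul, abs_mul, abs_of_nonneg (by positivity : 0 ≤ σ ^ 2 / (2 * θ) / π)]

end Heat

theorem IsCenteredGaussianField.map_increments {Ω : Type*} [MeasurableSpace Ω] {P : Measure Ω}
    {u : ℝ → Ω → ℝ} {S : Set ℝ} {C : ℝ → ℝ → ℝ} (hu : IsCenteredGaussianField P u S C)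
    (hC : ∀ x y, C x y = C y x) {x' x y' y : ℝ} (hx' : x' ∈ S) (hx : x ∈ S) (hy' : y' ∈ S)
    (hy : y ∈ S) (s t : ℝ) :
    P.map (fun ω => s * (u x ω - u x' ω) + t * (u y ω - u y' ω))
      = gaussianReal 0 (s ^ 2 * covIncrement C x' x x' x + 2 * s * t * covIncrement C x' x y' y
        + t ^ 2 * covIncrement C y' y y' y).toNNReal := by
  have h := hu 4 ![x, x', y, y'] (by intro i; fin_cases i <;> simpa) ![s, -s, t, -t]
  simp only [Fin.sum_univ_four, Matrix.cons_val_zero, Matrix.cons_val_one, Matrix.cons_val] at h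
  convert h using 2
  · funext ω; ring
  · congr 1
    unfold covIncrement
    rw [hC x' x, hC y x, hC y' x, hC y x', hC y' x', hC y' y]
    ring

theorem covIncrement_min_of_le {x' x y' y : ℝ} (h1 : x' ≤ x) (h2 : x ≤ y') (h3 : y' ≤ y) :
    covIncrement min x' x y' y = 0 := by
  unfold covIncrement
  rw [min_eq_left (h2.trans h3), min_eq_left h2, min_eq_left (h1.trans (h2.trans h3)),
    min_eq_left (h1.trans h2)]
  ring

theorem covIncrement_min_self {x' x : ℝ} (h : x' ≤ x) : covIncrement min x' x x' x = x - x' := by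
  simp [covIncrement, min_eq_left h, min_eq_right h]

theorem covIncrement_min_of_monotone {x : ℕ → ℝ} (hx : Monotone x) (i j : ℕ) :
    covIncrement min (x i) (x (i + 1)) (x j) (x (j + 1))
      = if i = j then x (i + 1) - x i else 0 := by
  rcases lt_trichotomy i j with h | rfl | h
  · rw [if_neg h.ne, covIncrement_min_of_le (hx i.le_succ) (hx h) (hx j.le_succ)]
  · rw [if_pos rfl, covIncrement_min_self (hx i.le_succ)]
  · rw [if_neg h.ne', covIncrement_comm min_comm,
      covIncrement_min_of_le (hx j.le_succ) (hx h) (hx i.le_succ)]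

/-- Bound on the mean square error of a sum of squares of almost uncorrelated variables. -/
theorem sum_diag_sub_sq_add_le {m : ℕ} {ρ : ℕ → ℕ → ℝ} {v e : ℝ}
    (h : ∀ i ∈ Finset.range m, ∀ j ∈ Finset.range m, |ρ i j - if i = j then v else 0| ≤ e) :
    (∑ i ∈ Finset.range m, ρ i i - m * v) ^ 2
        + 2 * ∑ i ∈ Finset.range m, ∑ j ∈ Finset.range m, ρ i j ^ 2
      ≤ 5 * (m * e) ^ 2 + 4 * (m * v ^ 2) := by
  have h1 : |∑ i ∈ Finset.range m, ρ i i - m * v| ≤ m * e := by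
    have : ∑ i ∈ Finset.range m, ρ i i - m * v = ∑ i ∈ Finset.range m, (ρ i i - v) := by
      simp
    rw [this]
    refine (Finset.abs_sum_le_sum_abs _ _).trans ((Finset.sum_le_card_nsmul _ _ e fun i hi => ?_).trans
      (by simp))
    simpa using h i hi i hi
  have h2 : ∑ i ∈ Finset.range m, ∑ j ∈ Finset.range m, ρ i j ^ 2
      ≤ ∑ i ∈ Finset.range m, ∑ j ∈ Finset.range m,
        (2 * e ^ 2 + if i = j then 2 * v ^ 2 else 0) := by
    refine Finset.sum_le_sum fun i hi => Finset.sum_le_sum fun j hj => ?_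
    have hij := sq_le_sq' (neg_le_of_abs_le (h i hi j hj)) (le_of_abs_le (h i hi j hj))
    split_ifs at hij ⊢
    · nlinarith [sq_nonneg (ρ i j - v - v)]
    · nlinarith
  have h3 : ∑ i ∈ Finset.range m, ∑ j ∈ Finset.range m,
      (2 * e ^ 2 + if i = j then 2 * v ^ 2 else 0) = 2 * (m * e) ^ 2 + 2 * (m * v ^ 2) := by
    have : ∀ i ∈ Finset.range m, ∑ j ∈ Finset.range m,
        (2 * e ^ 2 + if i = j then 2 * v ^ 2 else 0) = m * (2 * e ^ 2) + 2 * v ^ 2 := by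
      intro i hi
      rw [Finset.sum_add_distrib, Finset.sum_ite_eq, if_pos hi]
      simp
    rw [Finset.sum_congr rfl this]
    simp
    ring
  have h4 := sq_le_sq' (neg_le_of_abs_le h1) (le_of_abs_le h1)
  linarith

/-- Second and mixed fourth moments of the increments of the stochastic heat equation. -/
theorem IsCenteredGaussianField.integral_sq_mul_sq_increments {Ω : Type*} [MeasurableSpace Ω]
    {P : Measure Ω} [IsProbabilityMeasure P] {θ σ t : ℝ} {u : ℝ → Ω → ℝ} {S : Set ℝ}
    (hu : IsCenteredGaussianField P u S (heatCovSpace θ σ t)) (hθ : 0 < θ) (ht : 0 < t)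
    {x' x y' y : ℝ} (hx' : x' ∈ S) (hx : x ∈ S) (hy' : y' ∈ S) (hy : y ∈ S) :
    (Integrable (fun ω => (u x ω - u x' ω) ^ 2) P ∧
      ∫ ω, (u x ω - u x' ω) ^ 2 ∂P = covIncrement (heatCovSpace θ σ t) x' x x' x) ∧
    (Integrable (fun ω => (u x ω - u x' ω) ^ 2 * (u y ω - u y' ω) ^ 2) P ∧
      ∫ ω, (u x ω - u x' ω) ^ 2 * (u y ω - u y' ω) ^ 2 ∂P
        = covIncrement (heatCovSpace θ σ t) x' x x' x * covIncrement (heatCovSpace θ σ t) y' y y' y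
          + 2 * covIncrement (heatCovSpace θ σ t) x' x y' y ^ 2) := by
  rw [heatCovSpace_eq_sineCov] at hu ⊢
  exact integral_sq_mul_sq_of_gaussian
    (sineCov_quadratic_nonneg (summable_heatCov_weight hθ ht) (heatCov_weight_nonneg hθ ht) _ _ _ _)
    (hu.map_increments (sineCov_comm _) hx' hx hy' hy)

/-- The spatial quadratic variation of the stochastic heat equation at a fixed time,
along uniform partitions of `[a,b] ⊂ [0,π]`, converges in probability to
`σ²(b−a)/(2θ)`. -/
theorem stmt10 {Ω : Type*} [MeasurableSpace Ω] (P : Measure Ω) [IsProbabilityMeasure P]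
    (θ σ t a b : ℝ) (hθ : 0 < θ) (hσ : 0 < σ) (ht : 0 < t)
    (ha : 0 ≤ a) (hab : a < b) (hb : b ≤ π)
    (u : ℝ → Ω → ℝ)
    (hu : IsCenteredGaussianField P u (Set.Icc 0 π) (heatCovSpace θ σ t)) :
    TendstoInMeasure P
      (fun (m : ℕ) ω => ∑ j ∈ Finset.range m,
        (u (a + (b - a) * ((j : ℝ) + 1) / (m : ℝ)) ω
          - u (a + (b - a) * (j : ℝ) / (m : ℝ)) ω) ^ 2)
      atTop (fun _ => σ ^ 2 * (b - a) / (2 * θ)) := by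
  set x : ℕ → ℕ → ℝ := fun m j => a + (b - a) * (j : ℝ) / (m : ℝ) with hx
  set c : ℝ := σ ^ 2 / (2 * θ) with hc
  obtain ⟨K, hK⟩ := exists_abs_covIncrement_heatCov_sub_le (σ := σ) hθ ht
  have hba : 0 < b - a := sub_pos.2 hab
  have hmono (m : ℕ) : Monotone (x m) := fun i j hij => by
    simp only [hx]
    gcongr
  have hmem {m j : ℕ} (hm : 0 < m) (hj : j ≤ m) : x m j ∈ Set.Icc 0 π := by
    have h0 : x m 0 = a := by simp [hx]
    have h1 : x m m = b := by
      have : (m : ℝ) ≠ 0 := by positivity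
      simp only [hx]
      field_simp
      ring
    exact ⟨ha.trans (h0 ▸ hmono m j.zero_le), (h1 ▸ hmono m hj : x m j ≤ b).trans hb⟩
  have hstep (m j : ℕ) : x m (j + 1) - x m j = (b - a) / m := by
    simp only [hx]
    push_cast
    ring
  have hmain (m : ℕ) (hm : 0 < m) :
      Integrable (fun ω => (∑ j ∈ Finset.range m,
        (u (x m (j + 1)) ω - u (x m j) ω) ^ 2 - c * (b - a)) ^ 2) P ∧
      ∫ ω, (∑ j ∈ Finset.range m, (u (x m (j + 1)) ω - u (x m j) ω) ^ 2 - c * (b - a)) ^ 2 ∂P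
        ≤ 5 * (m * (K * ((b - a) / m * ((b - a) / m)))) ^ 2 + 4 * (m * (c * ((b - a) / m)) ^ 2) := by
    have hwick (i : ℕ) (hi : i ∈ Finset.range m) (j : ℕ) (hj : j ∈ Finset.range m) :=
      hu.integral_sq_mul_sq_increments hθ ht (hmem hm (Finset.mem_range.1 hi).le)
        (hmem hm (Finset.mem_range.1 hi)) (hmem hm (Finset.mem_range.1 hj).le)
        (hmem hm (Finset.mem_range.1 hj))
    have hdiag := sum_diag_sub_sq_add_le (m := m) (v := c * ((b - a) / m))
      (ρ := fun i j =>
        covIncrement (heatCovSpace θ σ t) (x m i) (x m (i + 1)) (x m j) (x m (j + 1)))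
      (e := K * ((b - a) / m * ((b - a) / m))) fun i hi j hj => by
        have h := hK _ (hmem hm (Finset.mem_range.1 hi).le) _ (hmem hm (Finset.mem_range.1 hi))
          _ (hmem hm (Finset.mem_range.1 hj).le) _ (hmem hm (Finset.mem_range.1 hj))
        rwa [covIncrement_min_of_monotone (hmono m), hstep, hstep, mul_ite, mul_zero,
          abs_of_nonneg (by positivity : 0 ≤ (b - a) / (m : ℝ))] at h
    have hL : m * (c * ((b - a) / m)) = c * (b - a) := by
      have : (m : ℝ) ≠ 0 := by positivity
      field_simp
    rw [hL] at hdiag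
    obtain ⟨hI, hE⟩ := integral_sum_sq_sub_sq (Finset.range m)
      (fun j ω => u (x m (j + 1)) ω - u (x m j) ω)
      (fun i j => covIncrement (heatCovSpace θ σ t) (x m i) (x m (i + 1)) (x m j) (x m (j + 1)))
      (c * (b - a)) (fun i hi => (hwick i hi i hi).1) (fun i hi j hj => (hwick i hi j hj).2)
    exact ⟨hI, hE.trans_le hdiag⟩
  have hsum : (fun (m : ℕ) ω => ∑ j ∈ Finset.range m,
        (u (a + (b - a) * ((j : ℝ) + 1) / (m : ℝ)) ω
          - u (a + (b - a) * (j : ℝ) / (m : ℝ)) ω) ^ 2)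
      = fun m ω => ∑ j ∈ Finset.range m, (u (x m (j + 1)) ω - u (x m j) ω) ^ 2 := by
    simp only [hx, Nat.cast_add, Nat.cast_one]
  have hL : σ ^ 2 * (b - a) / (2 * θ) = c * (b - a) := by rw [hc]; ring
  rw [hsum, hL]
  refine tendstoInMeasure_of_tendsto_integral_sq (fun m hm => (hmain m hm).1) ?_
  have hlim : Tendsto (fun m : ℕ => 5 * (K * (b - a) ^ 2 * (m : ℝ)⁻¹) ^ 2
      + 4 * ((c * (b - a)) ^ 2 * (m : ℝ)⁻¹)) atTop (nhds 0) := by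
    have h := tendsto_inv_atTop_nhds_zero_nat (𝕜 := ℝ)
    simpa using (((h.const_mul (K * (b - a) ^ 2)).pow 2).const_mul 5).add
      ((h.const_mul ((c * (b - a)) ^ 2)).const_mul 4)
  refine squeeze_zero' (Eventually.of_forall fun m => integral_nonneg fun ω => sq_nonneg _) ?_ hlim
  filter_upwards [eventually_gt_atTop 0] with m hm
  refine (hmain m hm).2.trans_eq ?_
  have : (m : ℝ) ≠ 0 := by positivity
  field_simp
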